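/- Let D ≥ 1 and, for each d ∈ {1,…,D}, let (u_d^r)_{r=1,…,R_d} be an orthonormal family of vectors in ℝ^{I_d}. Let G and E_1,…,E_{n_e} be core tensors (maps from ∏_{d=1}^D Fin R_d to ℝ), let B = [[G; U_1,…,U_D]] and Z_j = [[E_j; U_1,…,U_D]] be the corresponding Tucker-form tensors, let X_1,…,X_n be D-way tensors of dimensions I_1×…×I_D, let y_1,…,y_n ∈ ℝ, and let d ∈ ℝ. Then the two-block noise-augmented squared-error loss equals the original loss plus a quadratic penalty on the core tensor: Σ_{i=1}^n (y_i − ⟨X_i,B⟩)² + Σ_{j=1}^{n_e} (d − ⟨Z_j,B⟩)² + Σ_{j=1}^{n_e} (d − ⟨−Z_j,B⟩)² = Σ_{i=1}^n (y_i − ⟨X_i,B⟩)² + 2·Σ_{j=1}^{n_e} (Σ over multi-indices r of E_j(r)·G(r))² + 2·n_e·d². -/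

import Mathlib

open Finset

/-- With orthonormal factor vectors and Tucker-form noisy predictors and coefficient
tensor, the two-block noise-augmented squared-error loss equals the original loss
plus a quadratic penalty on the core tensor. -/
theorem two_block_augmented_loss_core_penalty
    (D : ℕ) (hD : 1 ≤ D) (I R : Fin D → ℕ)
    (u : ∀ d : Fin D, Fin (R d) → Fin (I d) → ℝ)
    (hu : ∀ d : Fin D, ∀ r s : Fin (R d),
      (∑ k : Fin (I d), u d r k * u d s k) = if r = s then 1 else 0)
    (n ne : ℕ)
    (G : (∀ d : Fin D, Fin (R d)) → ℝ)
    (E : Fin ne → (∀ d : Fin D, Fin (R d)) → ℝ)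
    (B : (∀ d : Fin D, Fin (I d)) → ℝ)
    (hB : ∀ k : ∀ d : Fin D, Fin (I d),
      B k = ∑ r : ∀ d : Fin D, Fin (R d), G r * ∏ d : Fin D, u d (r d) (k d))
    (Z : Fin ne → (∀ d : Fin D, Fin (I d)) → ℝ)
    (hZ : ∀ (j : Fin ne) (k : ∀ d : Fin D, Fin (I d)),
      Z j k = ∑ r : ∀ d : Fin D, Fin (R d), E j r * ∏ d : Fin D, u d (r d) (k d))
    (X : Fin n → (∀ d : Fin D, Fin (I d)) → ℝ)
    (y : Fin n → ℝ) (c : ℝ) :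
    (∑ i : Fin n, (y i - ∑ k, X i k * B k) ^ 2)
      + (∑ j : Fin ne, (c - ∑ k, Z j k * B k) ^ 2)
      + (∑ j : Fin ne, (c - ∑ k, (-(Z j k)) * B k) ^ 2)
    = (∑ i : Fin n, (y i - ∑ k, X i k * B k) ^ 2)
      + 2 * (∑ j : Fin ne, (∑ r : ∀ d : Fin D, Fin (R d), E j r * G r) ^ 2)
      + 2 * (ne : ℝ) * c ^ 2 := by
  have orth : ∀ r s : ∀ d : Fin D, Fin (R d),
      (∑ k : ∀ d : Fin D, Fin (I d),
        (∏ d : Fin D, u d (r d) (k d)) * ∏ d : Fin D, u d (s d) (k d))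
      = if r = s then 1 else 0 := by
    intro r s
    have h := Fintype.prod_sum (fun (d : Fin D) (k : Fin (I d)) => u d (r d) k * u d (s d) k)
    simp only [← Finset.prod_mul_distrib]
    rw [← h]
    simp only [hu]
    split_ifs with hrs
    · subst hrs
      simp
    · obtain ⟨d, hd⟩ := Function.ne_iff.mp hrs
      exact Finset.prod_eq_zero (Finset.mem_univ d) (if_neg hd)
  have key : ∀ j, ∑ k, Z j k * B k = ∑ r : ∀ d : Fin D, Fin (R d), E j r * G r := by
    intro j
    simp only [hB, hZ, Finset.sum_mul_sum]
    rw [Finset.sum_comm]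
    refine Finset.sum_congr rfl fun r _ => ?_
    rw [Finset.sum_comm]
    have h : ∀ s : ∀ d : Fin D, Fin (R d),
        (∑ k : ∀ d : Fin D, Fin (I d),
          E j r * (∏ d : Fin D, u d (r d) (k d)) * (G s * ∏ d : Fin D, u d (s d) (k d)))
        = E j r * G s * (if r = s then 1 else 0) := by
      intro s
      rw [← orth r s, Finset.mul_sum]
      exact Finset.sum_congr rfl fun k _ => by ring
    simp only [h]
    simp
  simp only [neg_mul, Finset.sum_neg_distrib, key]
  rw [add_assoc, add_assoc, ← Finset.sum_add_distrib]
  congr 1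
  have h2 : ∀ t : ℝ, (c - t) ^ 2 + (c - -t) ^ 2 = 2 * t ^ 2 + 2 * c ^ 2 := fun t => by ring
  simp only [h2, Finset.sum_add_distrib, ← Finset.mul_sum]
  simp
  ring
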